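/- (Global well-posedness under gauge invariance) Let $1<\gamma<\infty$ and let $F$ be a power-like nonlinearity of degree $\gamma$ satisfying the gauge invariance condition $\mathrm{Im}\,(F(u)\overline{u})=0$ for all $u\in\mathbb{C}$. Then for every $f\in L^2(\mathbb{T})$ the Cauchy problem $i\partial_t u+\mathcal{L}u=F(u)$, $u(0)=f$, understood via the integral equation $u(t)=e^{it\mathcal{L}}f-i\int_0^t e^{i(t-s)\mathcal{L}}F(u(s))\,ds$, has a unique global solution $u\in C(\mathbb{R};L^2(\mathbb{T}))\cap L^p_{loc}(\mathbb{R};L^q(\mathbb{T}))$ (for suitable exponents $p\in[2,\infty)$, $q\in(2,\infty)$ with $p>\gamma$, $q<2\gamma$), obtained by iterating the local solutions thanks to conservation of the $L^2$ norm. -/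

import Mathlib

noncomputable section

open Complex MeasureTheory Filter
open scoped ENNReal NNReal Topology

/-- A homogeneous tree of degree `Q+1`: a connected acyclic graph in which every
vertex has exactly `Q+1` neighbours. -/
structure HomTree (Q : ℕ) : Type 1 where
  V : Type
  graph : SimpleGraph V
  isTree : graph.IsTree
  regular : ∀ x : V, {y : V | graph.Adj x y}.ncard = Q + 1

/-- `γ(0) = 2/(Q^{1/2} + Q^{-1/2})`. -/
def gammaZero (Q : ℕ) : ℝ := 2 / (Real.sqrt Q + (Real.sqrt Q)⁻¹)

/-- The radial Schrödinger kernel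
`s_t(n) = e^{it} (2/π) ∑_{k≥0} Q^{-n/2-k} ∫₀^π e^{-iγ(0)t cos λ} sin λ sin((n+2k+1)λ) dλ`. -/
def schKernel (Q : ℕ) (t : ℝ) (n : ℕ) : ℂ :=
  Complex.exp (Complex.I * t) * (2 / Real.pi) *
    ∑' k : ℕ, (((Q : ℝ) ^ (-(n : ℝ) / 2 - (k : ℝ)) : ℝ) : ℂ) *
      ∫ l in (0 : ℝ)..Real.pi,
        Complex.exp (-Complex.I * (gammaZero Q) * t * Real.cos l) *
          (Real.sin l : ℂ) * (Real.sin (((n : ℝ) + 2 * k + 1) * l) : ℂ)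

/-- The sum of `g` over the sphere of radius `n` centred at `x`. -/
def sphereSum {Q : ℕ} (T : HomTree Q) (g : T.V → ℂ) (x : T.V) (n : ℕ) : ℂ :=
  ∑' y : {y : T.V // T.graph.dist x y = n}, g y

/-- The Schrödinger propagator `e^{itℒ}`, realised (and extended to all
`L^p` spaces) as convolution with the radial kernel `s_t`:
`e^{itℒ}g(x) = ∑_{n≥0} s_t(n) ∑_{d(x,y)=n} g(y)`. -/
def propagate {Q : ℕ} (T : HomTree Q) (t : ℝ) (g : T.V → ℂ) (x : T.V) : ℂ :=
  ∑' n : ℕ, schKernel Q t n * sphereSum T g x n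

/-- The `L^q(𝕋)` norm (with the counting measure), valued in `ℝ≥0∞`, for an
exponent `q : ℝ≥0∞`. -/
def spaceNorm {Q : ℕ} (T : HomTree Q) (q : ℝ≥0∞) (g : T.V → ℂ) : ℝ≥0∞ :=
  if q = ∞ then ⨆ x : T.V, (‖g x‖₊ : ℝ≥0∞)
  else (∑' x : T.V, (‖g x‖₊ : ℝ≥0∞) ^ q.toReal) ^ (1 / q.toReal)

/-- The mixed Lebesgue norm `L^p_t L^q_x` over a time set `A ⊆ ℝ`
(with `sup` in time when `p = ∞`), valued in `ℝ≥0∞`. -/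
def mixedNorm {Q : ℕ} (T : HomTree Q) (p q : ℝ≥0∞) (A : Set ℝ)
    (u : ℝ → T.V → ℂ) : ℝ≥0∞ :=
  if p = ∞ then ⨆ t ∈ A, spaceNorm T q (u t)
  else (∫⁻ t in A, (spaceNorm T q (u t)) ^ p.toReal) ^ (1 / p.toReal)

/-- The admissible set `𝒞 = ((0,1/2] × [0,1/2)) ∪ {(0,1/2)}` for the couple
`(1/p, 1/q)`. -/
def admissiblePair (p q : ℝ≥0∞) : Prop :=
  (0 < p⁻¹ ∧ p⁻¹ ≤ 2⁻¹ ∧ q⁻¹ < 2⁻¹) ∨ (p⁻¹ = 0 ∧ q⁻¹ = 2⁻¹)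

/-- A power-like nonlinearity of degree `γ`: `|F(u)| ≤ C|u|^γ` and
`|F(u)-F(v)| ≤ C(|u|^{γ-1} + |v|^{γ-1})|u-v|`. -/
def PowerLike (F : ℂ → ℂ) (γ : ℝ) : Prop :=
  ∃ C : ℝ, 0 < C ∧ (∀ u : ℂ, ‖F u‖ ≤ C * ‖u‖ ^ γ) ∧
    ∀ u v : ℂ, ‖F u - F v‖ ≤ C * (‖u‖ ^ (γ - 1) + ‖v‖ ^ (γ - 1)) * ‖u - v‖

/-- The gauge invariance condition `Im (F(u) ū) = 0`. -/
def GaugeInvariant (F : ℂ → ℂ) : Prop :=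
  ∀ u : ℂ, (F u * (starRingEnd ℂ) u).im = 0

/-- `u` solves the semilinear Schrödinger equation `i∂ₜu + ℒu = F(u)`, `u(0)=f`,
in the Duhamel (integral) form
`u(t) = e^{itℒ}f - i∫₀ᵗ e^{i(t-s)ℒ}F(u(s)) ds`, on the time set `A`. -/
def SolvesNLS {Q : ℕ} (T : HomTree Q) (F : ℂ → ℂ) (f : T.V → ℂ)
    (u : ℝ → T.V → ℂ) (A : Set ℝ) : Prop :=
  ∀ t ∈ A, ∀ x : T.V, u t x = propagate T t f x -
    Complex.I * ∫ s in (0 : ℝ)..t, propagate T (t - s) (fun y => F (u s y)) x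

/-- `u : A → L²(𝕋)` is continuous in the `L²` norm. -/
def ContL2On {Q : ℕ} (T : HomTree Q) (u : ℝ → T.V → ℂ) (A : Set ℝ) : Prop :=
  ∀ t₀ ∈ A, Filter.Tendsto (fun t => spaceNorm T 2 (fun x => u t x - u t₀ x))
    (nhdsWithin t₀ A) (nhds 0)

/-- The norm of the space `X = C(A; L²(𝕋)) ∩ L^p(A; L^q(𝕋))`. -/
def Xnorm {Q : ℕ} (T : HomTree Q) (p q : ℝ≥0∞) (A : Set ℝ)
    (u : ℝ → T.V → ℂ) : ℝ≥0∞ :=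
  (⨆ t ∈ A, spaceNorm T 2 (u t)) + mixedNorm T p q A u

theorem continuous_of_lipschitzOnWith_closedBall {E : Type*} [NormedAddCommGroup E] {N : E → E}
    (hN : ∀ R : ℝ, ∃ K, LipschitzOnWith K N (Metric.closedBall 0 R)) : Continuous N := by
  refine continuous_iff_continuousAt.2 fun x => ?_
  obtain ⟨K, hK⟩ := hN (‖x‖ + 1)
  refine hK.continuousOn.continuousAt (mem_of_superset (Metric.ball_mem_nhds x one_pos) ?_)
  refine Metric.ball_subset_closedBall.trans (Metric.closedBall_subset_closedBall' ?_)
  simp [add_comm]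

/-- A bounded, globally Lipschitz vector field has a global integral curve. -/
theorem exists_global_integralCurve {E : Type*} [NormedAddCommGroup E] [NormedSpace ℝ E]
    [CompleteSpace E] {v : E → E} {K B : ℝ≥0} (hv : LipschitzWith K v) (hB : ∀ x, ‖v x‖ ≤ B)
    (x₀ : E) : ∃ α : ℝ → E, α 0 = x₀ ∧ ∀ t, HasDerivAt α (v (α t)) t := by
  have local_sol : ∀ n : ℕ, ∃ α : ℝ → E, α 0 = x₀ ∧
      ∀ t ∈ Set.Ioo (-(n + 1 : ℝ)) (n + 1), HasDerivAt α (v (α t)) t := by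
    intro n
    have h0 : (0 : ℝ) ∈ Set.Icc (-(n + 1 : ℝ)) (n + 1) := by constructor <;> linarith [n.cast_nonneg (α := ℝ)]
    have hPL : IsPicardLindelof (fun _ => v) (⟨0, h0⟩ : Set.Icc (-(n + 1 : ℝ)) (n + 1)) x₀
        (B * (n + 1)) 0 B K :=
      { lipschitzOnWith := fun _ _ => hv.lipschitzOnWith
        continuousOn := fun _ _ => continuousOn_const
        norm_le := fun _ _ x _ => hB x
        mul_max_le := by simp }
    obtain ⟨α, hα0, hα⟩ := hPL.exists_eq_forall_mem_Icc_hasDerivWithinAt₀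
    exact ⟨α, hα0, fun t ht => (hα t (Set.Ioo_subset_Icc_self ht)).hasDerivAt
      (Icc_mem_nhds ht.1 ht.2)⟩
  choose α hα0 hα using local_sol
  have agree : ∀ m n : ℕ, m ≤ n → ∀ t ∈ Set.Ioo (-(m + 1 : ℝ)) (m + 1), α m t = α n t := by
    intro m n hmn
    have hmn' : (m : ℝ) ≤ n := by exact_mod_cast hmn
    refine ODE_solution_unique_of_mem_Ioo (v := fun _ => v) (s := fun _ => Set.univ) (K := K)
      (t₀ := 0)
      (fun _ _ => hv.lipschitzOnWith) ?_ (fun t ht => ⟨hα m t ht, trivial⟩)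
      (fun t ht => ⟨hα n t ⟨by linarith [ht.1], by linarith [ht.2]⟩, trivial⟩) (by simp [hα0])
    constructor <;> linarith [m.cast_nonneg (α := ℝ)]
  refine ⟨fun t => α ⌈|t|⌉₊ t, by simp [hα0], fun t => ?_⟩
  set n := ⌈|t|⌉₊ + 1
  have hlt : ∀ᶠ s : ℝ in 𝓝 t, |s| < n := by
    have : |t| < n := (Nat.le_ceil _).trans_lt (by simp [n])
    exact continuous_abs.continuousAt.eventually_lt_const this
  have heq : (fun s => α ⌈|s|⌉₊ s) =ᶠ[𝓝 t] α n := by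
    filter_upwards [hlt] with s hs
    refine agree _ _ (Nat.ceil_le.2 hs.le) s (abs_lt.1 ?_)
    exact (Nat.le_ceil _).trans_lt (by simp)
  have ht : t ∈ Set.Ioo (-(n + 1 : ℝ)) (n + 1) := abs_lt.1 (hlt.self_of_nhds.trans (lt_add_one _))
  have := (hα n t ht).congr_of_eventuallyEq heq
  rwa [← heq.self_of_nhds] at this

/-- The radial retraction onto the closed ball of radius `R`. -/
def radialRetraction {E : Type*} [NormedAddCommGroup E] [NormedSpace ℝ E] (R : ℝ) (u : E) : E :=
  (R / max R ‖u‖) • u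

section radialRetraction

variable {E : Type*} [NormedAddCommGroup E] [NormedSpace ℝ E] {R : ℝ}

theorem norm_radialRetraction_le (hR : 0 < R) (u : E) : ‖radialRetraction R u‖ ≤ R := by
  have hm : 0 < max R ‖u‖ := lt_max_of_lt_left hR
  rw [radialRetraction, norm_smul, Real.norm_of_nonneg (by positivity), div_mul_eq_mul_div,
    div_le_iff₀ hm]
  gcongr
  exact le_max_right _ _

theorem radialRetraction_of_norm_le (hR : 0 < R) {u : E} (hu : ‖u‖ ≤ R) :
    radialRetraction R u = u := by
  rw [radialRetraction, max_eq_left hu, div_self hR.ne', one_smul]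

theorem lipschitzWith_radialRetraction (hR : 0 < R) :
    LipschitzWith 2 (radialRetraction R : E → E) := by
  refine LipschitzWith.of_dist_le_mul fun u v => ?_
  have hu : 0 < max R ‖u‖ := lt_max_of_lt_left hR
  have hv : 0 < max R ‖v‖ := lt_max_of_lt_left hR
  have hcu : R / max R ‖u‖ ≤ 1 := (div_le_one hu).2 (le_max_left _ _)
  have hcu0 : 0 ≤ R / max R ‖u‖ := by positivity
  have hsplit : radialRetraction R u - radialRetraction R v =
      (R / max R ‖u‖) • (u - v) + (R / max R ‖u‖ - R / max R ‖v‖) • v := by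
    simp only [radialRetraction]; module
  have hdiff : R / max R ‖u‖ - R / max R ‖v‖ =
      (R / max R ‖u‖) * (max R ‖v‖ - max R ‖u‖) / max R ‖v‖ := by
    field_simp
  have habs : |max R ‖v‖ - max R ‖u‖| ≤ ‖u - v‖ := by
    rw [max_comm R, max_comm R, norm_sub_rev]
    exact (abs_max_sub_max_le_abs _ _ _).trans (abs_norm_sub_norm_le _ _)
  have h2 : |R / max R ‖u‖ - R / max R ‖v‖| * ‖v‖ ≤ ‖u - v‖ := by
    rw [hdiff, abs_div, abs_mul, abs_of_nonneg hcu0, abs_of_pos hv, div_mul_eq_mul_div,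
      div_le_iff₀ hv]
    have : R / max R ‖u‖ * |max R ‖v‖ - max R ‖u‖| ≤ ‖u - v‖ := by
      calc _ ≤ 1 * ‖u - v‖ := by gcongr
        _ = _ := one_mul _
    gcongr
    exact le_max_right _ _
  rw [dist_eq_norm, dist_eq_norm, hsplit]
  calc _ ≤ ‖(R / max R ‖u‖) • (u - v)‖ + ‖(R / max R ‖u‖ - R / max R ‖v‖) • v‖ := norm_add_le _ _
    _ = R / max R ‖u‖ * ‖u - v‖ + |R / max R ‖u‖ - R / max R ‖v‖| * ‖v‖ := by
        rw [norm_smul, norm_smul, Real.norm_of_nonneg hcu0, Real.norm_eq_abs]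
    _ ≤ 1 * ‖u - v‖ + ‖u - v‖ := by gcongr
    _ = _ := by push_cast; ring

end radialRetraction

section AbstractSchrodinger

variable {H : Type*} [NormedAddCommGroup H] [InnerProductSpace ℂ H]

/-- A curve whose velocity is `i` times a vector with real inner product against the position
stays on a sphere. -/
theorem norm_eq_of_hasDerivAt_I_smul {u w : ℝ → H} (hu : ∀ t, HasDerivAt u (I • w t) t)
    (hw : ∀ t, (inner ℂ (u t) (w t)).im = 0) (t : ℝ) : ‖u t‖ = ‖u 0‖ := by
  have hderiv : ∀ t, HasDerivAt (fun t => inner ℂ (u t) (u t)) 0 t := by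
    intro t
    have h := (hu t).inner ℂ (hu t)
    suffices inner ℂ (u t) (I • w t) + inner ℂ (I • w t) (u t) = 0 by rwa [this] at h
    rw [inner_smul_right, inner_smul_left, ← inner_conj_symm (w t) (u t)]
    apply Complex.ext <;> simp [hw t, -inner_conj_symm]
  have hconst := is_const_of_deriv_eq_zero (fun t => (hderiv t).differentiableAt)
    (fun t => (hderiv t).deriv) t 0
  simp only [inner_self_eq_norm_sq_to_K] at hconst
  have : ‖u t‖ ^ 2 = ‖u 0‖ ^ 2 := by exact_mod_cast hconst
  exact (pow_left_inj₀ (norm_nonneg _) (norm_nonneg _) two_ne_zero).1 this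

variable [CompleteSpace H]

/-- The group `e^{itA}`. -/
def expGroup (A : H →L[ℂ] H) (t : ℝ) : H →L[ℂ] H := NormedSpace.exp (t • (I • A))

theorem expGroup_zero (A : H →L[ℂ] H) : expGroup A 0 = 1 := by
  simp [expGroup]

theorem expGroup_add (A : H →L[ℂ] H) (s t : ℝ) :
    expGroup A (s + t) = expGroup A s * expGroup A t := by
  let _ := NormedAlgebra.restrictScalars ℚ ℂ (H →L[ℂ] H)
  rw [expGroup, add_smul]
  exact NormedSpace.exp_add_of_commute (((Commute.refl _).smul_left _).smul_right _)

theorem exp_smul_eq_smul_expGroup_one_sub (M : H →L[ℂ] H) (t : ℝ) :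
    NormedSpace.exp ((-I * t : ℂ) • M) = Complex.exp (-(I * t)) • expGroup (1 - M) t := by
  let _ := NormedAlgebra.restrictScalars ℚ ℂ (H →L[ℂ] H)
  have hsplit : (-I * t : ℂ) • M = algebraMap ℂ (H →L[ℂ] H) (-(I * t)) +
      t • (I • (1 - M)) := by
    rw [Algebra.algebraMap_eq_smul_one, ← Complex.coe_smul, smul_smul]
    module
  rw [hsplit, NormedSpace.exp_add_of_commute (Algebra.commute_algebraMap_left _ _),
    ← NormedSpace.algebraMap_exp_comm, ← Complex.exp_eq_exp_ℂ, Algebra.algebraMap_eq_smul_one,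
    smul_one_mul, expGroup]

theorem hasDerivAt_expGroup (A : H →L[ℂ] H) (t : ℝ) :
    HasDerivAt (expGroup A) ((I • A) * expGroup A t) t :=
  hasDerivAt_exp_smul_const' (I • A) t

theorem continuous_expGroup (A : H →L[ℂ] H) : Continuous (expGroup A) :=
  continuous_iff_continuousAt.2 fun t => (hasDerivAt_expGroup A t).continuousAt

theorem expGroup_mul_neg (A : H →L[ℂ] H) (t : ℝ) : expGroup A t * expGroup A (-t) = 1 := by
  rw [← expGroup_add, add_neg_cancel, expGroup_zero]

/-- `e^{itA}` applied to a differentiable curve. -/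
theorem HasDerivAt.expGroup_apply (A : H →L[ℂ] H) {w : ℝ → H} {w' : H} {t : ℝ}
    (hw : HasDerivAt w w' t) :
    HasDerivAt (fun s => expGroup A s (w s))
      (I • A (expGroup A t (w t)) + expGroup A t w') t := by
  have h := (hasDerivAt_expGroup A t)
  have := ((ContinuousLinearMap.restrictScalarsL ℂ H H ℝ ℝ).hasFDerivAt.comp_hasDerivAt t h).clm_apply hw
  simpa using! this

/-- The Duhamel formulation of `u' = i (A u - N u)`. -/
def IsDuhamelSolution (A : H →L[ℂ] H) (N : H → H) (f : H) (u : ℝ → H) : Prop :=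
  ∀ t, u t = expGroup A t f - I • ∫ s in (0 : ℝ)..t, expGroup A (t - s) (N (u s))

variable {A : H →L[ℂ] H} {N : H → H}

theorem duhamel_integral_eq (A : H →L[ℂ] H) {g : ℝ → H} (hg : Continuous g) (t : ℝ) :
    ∫ s in (0 : ℝ)..t, expGroup A (t - s) (g s) =
      expGroup A t (∫ s in (0 : ℝ)..t, expGroup A (-s) (g s)) := by
  have hcont : Continuous fun s => expGroup A (-s) (g s) :=
    ((continuous_expGroup A).comp continuous_neg).clm_apply hg
  rw [← ContinuousLinearMap.intervalIntegral_comp_comm _ (hcont.intervalIntegrable 0 t)]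
  simp_rw [sub_eq_add_neg, expGroup_add]
  rfl

theorem IsDuhamelSolution.hasDerivAt {f : H} {u : ℝ → H} (hN : Continuous N)
    (hu : Continuous u) (h : IsDuhamelSolution A N f u) (t : ℝ) :
    HasDerivAt u (I • (A (u t) - N (u t))) t := by
  have hcont : Continuous fun s => expGroup A (-s) (N (u s)) :=
    ((continuous_expGroup A).comp continuous_neg).clm_apply (hN.comp hu)
  have hrep : u = fun t => expGroup A t (f - I • ∫ s in (0 : ℝ)..t, expGroup A (-s) (N (u s))) := by
    funext t
    rw [map_sub, map_smul, ← duhamel_integral_eq A (g := fun s => N (u s)) (hN.comp hu)]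
    exact h t
  have hint : HasDerivAt (fun t => f - I • ∫ s in (0 : ℝ)..t, expGroup A (-s) (N (u s)))
      (-(I • expGroup A (-t) (N (u t)))) t :=
    ((hcont.integral_hasStrictDerivAt 0 t).hasDerivAt.const_smul I).const_sub f
  have := hint.expGroup_apply A
  rw [← congrFun hrep t] at this
  rw [← hrep] at this
  convert this using 1
  rw [map_neg, map_smul, ← mul_apply_eq_comp, expGroup_mul_neg, smul_sub,
    sub_eq_add_neg]
  rfl

theorem isDuhamelSolution_of_hasDerivAt {u : ℝ → H} (hN : Continuous N)
    (hu : ∀ t, HasDerivAt u (I • (A (u t) - N (u t))) t) : IsDuhamelSolution A N (u 0) u := by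
  intro t
  have hucont : Continuous u := continuous_iff_continuousAt.2 fun t => (hu t).continuousAt
  have hcont : Continuous fun s => expGroup A (-s) (N (u s)) :=
    ((continuous_expGroup A).comp continuous_neg).clm_apply (hN.comp hucont)
  have hneg : ∀ s, expGroup (-A) s = expGroup A (-s) := fun s => by simp [expGroup]
  have hd : ∀ s, HasDerivAt (fun s => expGroup A (-s) (u s))
      (-(I • expGroup A (-s) (N (u s)))) s := by
    intro s
    have hcomm : A (expGroup A (-s) (u s)) = expGroup A (-s) (A (u s)) := by
      have : Commute A (expGroup A (-s)) := by
        refine Commute.exp_right ?_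
        exact (((Commute.refl A).smul_right _).smul_right _)
      exact congrArg (fun B : H →L[ℂ] H => B (u s)) this.eq
    have := (hu s).expGroup_apply (-A)
    simp only [hneg] at this
    convert this using 1
    rw [map_smul, map_sub, neg_apply, hcomm]
    module
  have hint := intervalIntegral.integral_eq_sub_of_hasDerivAt (fun s _ => hd s)
    ((hcont.const_smul I).neg.intervalIntegrable 0 t)
  rw [intervalIntegral.integral_neg, intervalIntegral.integral_smul] at hint
  simp only [neg_zero, expGroup_zero, one_apply_eq_self] at hint
  rw [duhamel_integral_eq A (g := fun s => N (u s)) (hN.comp hucont), ← map_smul, ← map_sub]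
  have : u 0 - I • ∫ s in (0 : ℝ)..t, expGroup A (-s) (N (u s)) = expGroup A (-t) (u t) := by
    rw [sub_eq_add_neg, hint]; abel
  rw [this, ← mul_apply_eq_comp, expGroup_mul_neg]
  rfl

/-- Global well-posedness of `u' = i (A u - N u)` when `A` is symmetric and `N` is Lipschitz on
balls and gauge invariant. -/
theorem existsUnique_duhamelSolution (hA : ∀ u, (inner ℂ u (A u)).im = 0)
    (hN : ∀ R : ℝ, ∃ K, LipschitzOnWith K N (Metric.closedBall 0 R))
    (hgauge : ∀ u, (inner ℂ u (N u)).im = 0) (f : H) :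
    ∃! u : ℝ → H, Continuous u ∧ IsDuhamelSolution A N f u := by
  have hNcont : Continuous N := continuous_of_lipschitzOnWith_closedBall hN
  set V : H → H := fun u => I • (A u - N u)
  have hVlip : ∀ R : ℝ, ∃ K, LipschitzOnWith K V (Metric.closedBall 0 R) := fun R => by
    obtain ⟨K, hK⟩ := hN R
    refine ⟨‖I‖₊ * (‖A‖₊ + K), LipschitzOnWith.of_dist_le_mul fun x hx y hy => ?_⟩
    have h1 := (A.lipschitz.lipschitzOnWith.sub hK).dist_le_mul x hx y hy
    simpa [V, dist_smul₀] using h1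
  have hzero : ∀ u, IsDuhamelSolution A N f u → u 0 = f := fun u hu => by
    simpa [expGroup_zero] using hu 0
  have himag : ∀ u, (inner ℂ u (A u - N u)).im = 0 := fun u => by
    rw [inner_sub_right, sub_im, hA, hgauge, sub_zero]
  have hmass : ∀ u : ℝ → H, (∀ t, HasDerivAt u (V (u t)) t) → ∀ t, ‖u t‖ = ‖u 0‖ :=
    fun u hu => norm_eq_of_hasDerivAt_I_smul hu fun t => himag (u t)
  set R := ‖f‖ + 1
  have hR : 0 < R := by positivity
  obtain ⟨K, hK⟩ := hVlip R
  have hmaps : ∀ u : H, radialRetraction R u ∈ Metric.closedBall 0 R := fun u => by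
    simpa using norm_radialRetraction_le hR u
  set W : H → H := fun u => V (radialRetraction R u)
  have hWlip : LipschitzWith (K * 2) W := by
    rw [← lipschitzOnWith_univ]
    exact hK.comp (lipschitzWith_radialRetraction hR).lipschitzOnWith fun u _ => hmaps u
  have hWbd : ∀ x, ‖W x‖ ≤ ((‖V 0‖₊ + K * R.toNNReal : ℝ≥0) : ℝ) := fun x => by
    have h1 := hK.dist_le_mul _ (hmaps x) 0 (by simpa using hR.le)
    rw [dist_zero_right, dist_eq_norm] at h1
    have h2 : ‖W x‖ ≤ ‖V 0‖ + ‖V (radialRetraction R x) - V 0‖ := by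
      simpa [W] using norm_add_le (V 0) (V (radialRetraction R x) - V 0)
    have h3 : (K : ℝ) * ‖radialRetraction R x‖ ≤ K * R := by
      gcongr; exact norm_radialRetraction_le hR x
    push_cast
    rw [Real.coe_toNNReal _ hR.le]
    linarith
  obtain ⟨u, hu0, hu⟩ := exists_global_integralCurve hWlip hWbd f
  have hunorm : ∀ t, ‖u t‖ = ‖f‖ := fun t => by
    rw [← hu0]
    refine norm_eq_of_hasDerivAt_I_smul hu (fun t => ?_) t
    set z := radialRetraction R (u t) with hz
    have hm : 0 < max R ‖u t‖ := lt_max_of_lt_left hR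
    have huz : u t = (((max R ‖u t‖ / R : ℝ)) : ℂ) • z := by
      rw [hz, radialRetraction, Complex.coe_smul, smul_smul]
      field_simp
      simp
    rw [huz, inner_smul_left, conj_ofReal, im_ofReal_mul, himag, mul_zero]
  have huV : ∀ t, HasDerivAt u (V (u t)) t := fun t => by
    have := hu t
    simp only [W] at this
    rwa [radialRetraction_of_norm_le hR (by rw [hunorm]; simp [R])] at this
  refine ⟨u, ⟨continuous_iff_continuousAt.2 fun t => (hu t).continuousAt,
    hu0 ▸ isDuhamelSolution_of_hasDerivAt hNcont huV⟩, fun w ⟨hwc, hw⟩ => ?_⟩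
  have hwV : ∀ t, HasDerivAt w (V (w t)) t := hw.hasDerivAt hNcont hwc
  refine ODE_solution_unique_univ (v := fun _ => V) (s := fun _ => Metric.closedBall 0 R)
    (t₀ := 0) (fun _ => hK) (fun t => ⟨hwV t, ?_⟩) (fun t => ⟨huV t, ?_⟩)
    (by rw [hzero w hw, hu0])
  · rw [mem_closedBall_zero_iff, hmass w hwV, hzero w hw]; simp [R]
  · rw [mem_closedBall_zero_iff, hunorm]; simp [R]

end AbstractSchrodinger

namespace SimpleGraph

variable {V : Type*} {G : SimpleGraph V}

/-- In a tree, a vertex `x ≠ z` has exactly one neighbour closer to `z`. -/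
theorem IsTree.existsUnique_adj_dist_succ (hG : G.IsTree) {x z : V} (hxz : x ≠ z) :
    ∃! y, G.Adj x y ∧ G.dist y z + 1 = G.dist x z := by
  obtain ⟨p, hp, hpl⟩ := hG.connected.exists_path_of_dist x z
  have step : ∀ y (h : G.Adj x y), G.dist y z + 1 = G.dist x z →
      ∃ q : G.Walk y z, (Walk.cons h q).IsPath := by
    intro y h hy
    obtain ⟨q, -, hql⟩ := hG.connected.exists_path_of_dist y z
    exact ⟨q, Walk.isPath_of_length_eq_dist _ (by simp [hql, hy])⟩
  cases p with
  | nil => exact absurd rfl hxz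
  | @cons _ y _ h q =>
    refine ⟨y, ⟨h, ?_⟩, fun y' ⟨h', hy'⟩ => ?_⟩
    · have h1 := dist_le q
      have h2 := hG.connected.dist_triangle (u := x) (v := y) (w := z)
      rw [dist_eq_one_iff_adj.2 h] at h2
      simp only [Walk.length_cons] at hpl
      omega
    · obtain ⟨q', hq'⟩ := step y' h' hy'
      have := hG.existsUnique_path x z |>.unique hp hq'
      simp only [Walk.cons.injEq] at this
      exact this.1.symm

end SimpleGraph

namespace HomTree

variable {Q : ℕ} (T : HomTree Q)

theorem finite_setOf_adj (x : T.V) : {y : T.V | T.graph.Adj x y}.Finite :=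
  Set.finite_of_ncard_ne_zero (by rw [T.regular]; omega)

/-- The finite set of neighbours of a vertex. -/
def nbr (x : T.V) : Finset T.V := (T.finite_setOf_adj x).toFinset

@[simp]
theorem mem_nbr {x y : T.V} : y ∈ T.nbr x ↔ T.graph.Adj x y := by
  simp [nbr]

theorem card_nbr (x : T.V) : (T.nbr x).card = Q + 1 := by
  rw [← T.regular x, Set.ncard_eq_toFinset_card _ (T.finite_setOf_adj x)]
  rfl

theorem sum_nbr_self {M : Type*} [Semiring M] (w : ℕ → M) (x : T.V) :
    ∑ y ∈ T.nbr x, w (T.graph.dist y x) = (Q + 1) * w 1 := by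
  have : ∀ y ∈ T.nbr x, w (T.graph.dist y x) = w 1 := fun y hy => by
    rw [SimpleGraph.dist_eq_one_iff_adj.2 (T.mem_nbr.1 hy).symm]
  rw [Finset.sum_congr rfl this, Finset.sum_const, card_nbr, nsmul_eq_mul]
  push_cast
  rfl

theorem sum_nbr_of_dist_eq_succ {M : Type*} [Semiring M] (w : ℕ → M) {x z : T.V} {m : ℕ}
    (h : T.graph.dist x z = m + 1) :
    ∑ y ∈ T.nbr x, w (T.graph.dist y z) = w m + Q * w (m + 2) := by
  classical
  have hxz : x ≠ z := by rintro rfl; simp at h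
  obtain ⟨y₀, ⟨hadj, hy₀⟩, huniq⟩ := T.isTree.existsUnique_adj_dist_succ hxz
  have hmem : y₀ ∈ T.nbr x := T.mem_nbr.2 hadj
  have hfar : ∀ y ∈ (T.nbr x).erase y₀, w (T.graph.dist y z) = w (m + 2) := fun y hy => by
    rw [Finset.mem_erase, mem_nbr] at hy
    have := T.isTree.dist_eq_dist_add_one_of_adj z hy.2
    rw [SimpleGraph.dist_comm (u := z), SimpleGraph.dist_comm (u := z)] at this
    rcases this with h' | h'
    · exact absurd (huniq y ⟨hy.2, h'.symm⟩) hy.1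
    · rw [h', h]
  rw [← Finset.add_sum_erase _ _ hmem, Finset.sum_congr rfl hfar, Finset.sum_const,
    Finset.card_erase_of_mem hmem, card_nbr, nsmul_eq_mul, show T.graph.dist y₀ z = m by omega]
  simp

end HomTree

/-- The `n`-th value of the radial kernel of the `j`-step simple random walk on the homogeneous
tree of degree `Q + 1`. -/
def walkKernel (Q : ℕ) : ℕ → ℕ → ℝ
  | 0, n => if n = 0 then 1 else 0
  | j + 1, 0 => walkKernel Q j 1
  | j + 1, n + 1 => (walkKernel Q j n + Q * walkKernel Q j (n + 2)) / (Q + 1)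

theorem walkKernel_nonneg (Q : ℕ) : ∀ j n, 0 ≤ walkKernel Q j n
  | 0, n => by rw [walkKernel]; split_ifs <;> norm_num
  | j + 1, 0 => walkKernel_nonneg Q j 1
  | j + 1, n + 1 => by
    have := walkKernel_nonneg Q j n
    have := walkKernel_nonneg Q j (n + 2)
    rw [walkKernel]; positivity

theorem gammaZero_nonneg (Q : ℕ) : 0 ≤ gammaZero Q := by
  unfold gammaZero; positivity

theorem gammaZero_le_one {Q : ℕ} (hQ : 2 ≤ Q) : gammaZero Q ≤ 1 := by
  have hQ' : (0 : ℝ) < Q := by positivity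
  have hs : 0 < Real.sqrt Q := Real.sqrt_pos.2 hQ'
  rw [gammaZero, div_le_one (by positivity)]
  field_simp
  nlinarith [sq_nonneg (Real.sqrt Q - 1)]

/-- The sine moments `∫₀^π (γ(0) cos λ)^j sin λ sin(aλ) dλ`. -/
def sineMoment (Q j : ℕ) (a : ℝ) : ℝ :=
  ∫ l in (0 : ℝ)..Real.pi, (gammaZero Q * Real.cos l) ^ j * Real.sin l * Real.sin (a * l)

theorem sineMoment_zero_right (Q j : ℕ) : sineMoment Q j 0 = 0 := by
  simp [sineMoment]

theorem sineMoment_succ (Q j : ℕ) (a : ℝ) :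
    sineMoment Q (j + 1) a =
      gammaZero Q / 2 * (sineMoment Q j (a + 1) + sineMoment Q j (a - 1)) := by
  unfold sineMoment
  rw [← intervalIntegral.integral_add, ← intervalIntegral.integral_const_mul]
  · refine intervalIntegral.integral_congr fun l _ => ?_
    have h1 : Real.sin ((a + 1) * l) + Real.sin ((a - 1) * l) =
        2 * Real.cos l * Real.sin (a * l) := by
      rw [add_mul, sub_mul, one_mul, Real.sin_add, Real.sin_sub]; ring
    rw [← mul_add, h1]; ring
  all_goals exact Continuous.intervalIntegrable (by fun_prop) _ _

theorem sineMoment_zero_left (Q m : ℕ) :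
    sineMoment Q 0 (m + 1) = if m = 0 then Real.pi / 2 else 0 := by
  unfold sineMoment
  split_ifs with h
  · subst h
    have : ∀ l : ℝ, (gammaZero Q * Real.cos l) ^ 0 * Real.sin l * Real.sin (((0 : ℕ) + 1 : ℝ) * l) =
        Real.sin l ^ 2 := fun l => by simp; ring
    simp_rw [this, integral_sin_sq]
    simp
  · have hm : (m : ℝ) ≠ 0 := by exact_mod_cast h
    have hm2 : (m : ℝ) + 2 ≠ 0 := by positivity
    have hF : ∀ l ∈ Set.uIcc 0 Real.pi, HasDerivAt
        (fun l : ℝ => Real.sin (m * l) / (2 * m) - Real.sin ((m + 2) * l) / (2 * (m + 2)))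
        ((gammaZero Q * Real.cos l) ^ 0 * Real.sin l * Real.sin ((m + 1) * l)) l := by
      intro l _
      have h1 : HasDerivAt (fun l : ℝ => Real.sin (m * l)) (Real.cos (m * l) * m) l := by
        simpa using ((hasDerivAt_id l).const_mul (m : ℝ)).sin
      have h2 : HasDerivAt (fun l : ℝ => Real.sin ((m + 2) * l))
          (Real.cos ((m + 2) * l) * (m + 2)) l := by
        simpa using ((hasDerivAt_id l).const_mul ((m : ℝ) + 2)).sin
      convert! (h1.div_const (2 * (m : ℝ))).sub (h2.div_const (2 * ((m : ℝ) + 2))) using 1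
      have e1 : (m : ℝ) * l = (m + 1) * l - l := by ring
      have e2 : ((m : ℝ) + 2) * l = (m + 1) * l + l := by ring
      rw [e1, e2, Real.cos_sub, Real.cos_add]
      field_simp
      ring
    rw [intervalIntegral.integral_eq_sub_of_hasDerivAt hF
      (Continuous.intervalIntegrable (by fun_prop) _ _)]
    have h1 : Real.sin (m * Real.pi) = 0 := Real.sin_nat_mul_pi m
    have h2 : Real.sin ((m + 2) * Real.pi) = 0 := by exact_mod_cast Real.sin_nat_mul_pi (m + 2)
    simp [h1, h2]

theorem abs_sineMoment_le {Q : ℕ} (hQ : 2 ≤ Q) (j : ℕ) (a : ℝ) : |sineMoment Q j a| ≤ Real.pi := by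
  have := intervalIntegral.norm_integral_le_of_norm_le_const (a := 0) (b := Real.pi) (C := 1)
    (f := fun l => (gammaZero Q * Real.cos l) ^ j * Real.sin l * Real.sin (a * l)) fun l _ => by
      have h1 : |gammaZero Q * Real.cos l| ≤ 1 := by
        rw [abs_mul, abs_of_nonneg (gammaZero_nonneg Q)]
        exact mul_le_one₀ (gammaZero_le_one hQ) (abs_nonneg _) (Real.abs_cos_le_one l)
      rw [Real.norm_eq_abs, abs_mul, abs_mul, abs_pow]
      exact mul_le_one₀ (mul_le_one₀ (pow_le_one₀ (abs_nonneg _) h1) (abs_nonneg _)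
        (Real.abs_sin_le_one _)) (abs_nonneg _) (Real.abs_sin_le_one _)
  simpa [sineMoment, abs_of_pos Real.pi_pos] using this

theorem rpow_neg_half_sub_eq {Q : ℕ} (hQ : 2 ≤ Q) (n k : ℕ) :
    (Q : ℝ) ^ (-(n : ℝ) / 2 - (k : ℝ)) = (Real.sqrt Q)⁻¹ ^ (n + 2 * k) := by
  have hQ' : (0 : ℝ) ≤ Q := by positivity
  rw [Real.sqrt_eq_rpow, ← Real.rpow_neg hQ', ← Real.rpow_mul_natCast hQ']
  congr 1
  push_cast
  ring

theorem hasSum_walkKernel {Q : ℕ} (hQ : 2 ≤ Q) (j n : ℕ) :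
    HasSum (fun k : ℕ => (Real.sqrt Q)⁻¹ ^ (n + 2 * k) *
      (2 / Real.pi * sineMoment Q j (n + 2 * k + 1))) (walkKernel Q j n) := by
  have hQ' : (0 : ℝ) < Q := by positivity
  set r := (Real.sqrt Q)⁻¹ with hr
  have hr0 : 0 < r := inv_pos.2 (Real.sqrt_pos.2 hQ')
  have hQr : (Q : ℝ) = (r ^ 2)⁻¹ := by rw [hr, inv_pow, inv_inv, Real.sq_sqrt hQ'.le]
  have hγ : gammaZero Q / 2 = r / (1 + r ^ 2) := by
    rw [gammaZero, ← hr, show Real.sqrt Q = r⁻¹ by rw [hr, inv_inv]]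
    field_simp
  induction j generalizing n with
  | zero =>
    have hval : ∀ k : ℕ, sineMoment Q 0 (n + 2 * k + 1) = if n + 2 * k = 0 then Real.pi / 2 else 0 :=
      fun k => by rw [← sineMoment_zero_left]; push_cast; rfl
    have hpi := Real.pi_ne_zero
    simp only [hval]
    convert! hasSum_ite_eq 0 (walkKernel Q 0 n) using 2 with k
    rw [walkKernel]
    rcases eq_or_ne k 0 with rfl | hk
    · rcases eq_or_ne n 0 with rfl | hn
      · simp [hpi]
      · simp [hn]
    · simp [hk]
  | succ j ih =>
    cases n with
    | zero =>
      have h1 := ih 1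
      have h2 : HasSum (fun k : ℕ => r ^ (2 * k + 1) * (2 / Real.pi * sineMoment Q j (2 * k)))
          (r ^ 2 * walkKernel Q j 1) := by
        rw [← hasSum_nat_add_iff' 1]
        simp only [Finset.sum_range_one, Nat.cast_zero, mul_zero, sineMoment_zero_right, sub_zero]
        convert! h1.mul_left (r ^ 2) using 2 with k
        push_cast
        rw [show (2 : ℝ) * (k + 1) = 1 + 2 * k + 1 by ring]
        ring
      have h3 := (h1.add h2).mul_left (1 + r ^ 2)⁻¹
      have hval : walkKernel Q (j + 1) 0 =
          (1 + r ^ 2)⁻¹ * (walkKernel Q j 1 + r ^ 2 * walkKernel Q j 1) := by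
        rw [walkKernel]; field_simp
      rw [hval]
      convert! h3 using 2 with k
      rw [sineMoment_succ, hγ]
      push_cast
      have e1 : (0 : ℝ) + 2 * k + 1 - 1 = 2 * k := by ring
      have e2 : (0 : ℝ) + 2 * k + 1 + 1 = 1 + 2 * k + 1 := by ring
      rw [e1, e2]
      field_simp
      ring
    | succ n =>
      have h1 := ((ih n).mul_left (r ^ 2)).add (ih (n + 2)) |>.mul_left (1 + r ^ 2)⁻¹
      have hval : walkKernel Q (j + 1) (n + 1) =
          (1 + r ^ 2)⁻¹ * (r ^ 2 * walkKernel Q j n + walkKernel Q j (n + 2)) := by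
        rw [walkKernel, hQr]; field_simp
      rw [hval]
      convert! h1 using 2 with k
      rw [sineMoment_succ, hγ]
      push_cast
      have e1 : (n : ℝ) + 1 + 2 * k + 1 - 1 = n + 2 * k + 1 := by ring
      have e2 : (n : ℝ) + 1 + 2 * k + 1 + 1 = n + 2 + 2 * k + 1 := by ring
      rw [e1, e2]
      field_simp
      ring

theorem norm_neg_I_mul_pow_div_factorial (t : ℝ) (j : ℕ) :
    ‖(-I * t) ^ j / (j.factorial : ℂ)‖ = |t| ^ j / j.factorial := by
  simp

theorem hasSum_integral_schKernel {Q : ℕ} (hQ : 2 ≤ Q) (t a : ℝ) :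
    HasSum (fun j : ℕ => (-I * t) ^ j / (j.factorial : ℂ) * sineMoment Q j a)
      (∫ l in (0 : ℝ)..Real.pi, Complex.exp (-I * (gammaZero Q) * t * Real.cos l) *
          (Real.sin l : ℂ) * (Real.sin (a * l) : ℂ)) := by
  have hterm : ∀ j : ℕ, (-I * t) ^ j / (j.factorial : ℂ) * sineMoment Q j a =
      ∫ l in (0 : ℝ)..Real.pi, (-I * t) ^ j / (j.factorial : ℂ) *
        (((gammaZero Q * Real.cos l) ^ j * Real.sin l * Real.sin (a * l) : ℝ) : ℂ) := fun j => by
    rw [intervalIntegral.integral_const_mul, intervalIntegral.integral_ofReal, sineMoment]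
  simp_rw [hterm]
  refine intervalIntegral.hasSum_integral_of_dominated_convergence
    (fun j _ => |t| ^ j / j.factorial) (fun j => Continuous.aestronglyMeasurable (by fun_prop))
    (fun j => ae_of_all _ fun l _ => ?_)
    (ae_of_all _ fun l _ => Real.summable_pow_div_factorial _)
    intervalIntegrable_const (ae_of_all _ fun l _ => ?_)
  · have h1 : |gammaZero Q * Real.cos l| ≤ 1 := by
      rw [abs_mul, abs_of_nonneg (gammaZero_nonneg Q)]
      exact mul_le_one₀ (gammaZero_le_one hQ) (abs_nonneg _) (Real.abs_cos_le_one l)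
    rw [norm_mul, norm_neg_I_mul_pow_div_factorial, Complex.norm_real, Real.norm_eq_abs, abs_mul,
      abs_mul, abs_pow]
    refine mul_le_of_le_one_right (by positivity) ?_
    exact mul_le_one₀ (mul_le_one₀ (pow_le_one₀ (abs_nonneg _) h1) (abs_nonneg _)
        (Real.abs_sin_le_one _)) (abs_nonneg _) (Real.abs_sin_le_one _)
  · have h := NormedSpace.expSeries_div_hasSum_exp (-I * (gammaZero Q) * t * Real.cos l)
    rw [← Complex.exp_eq_exp_ℂ] at h
    convert! (h.mul_right (Real.sin l : ℂ)).mul_right (Real.sin (a * l) : ℂ) using 2 with j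
    push_cast
    ring

theorem summable_geometric_mul_sineMoment {Q : ℕ} (hQ : 2 ≤ Q) (t : ℝ) (n : ℕ) :
    Summable fun p : ℕ × ℕ => (((Real.sqrt Q)⁻¹ ^ (n + 2 * p.1) : ℝ) : ℂ) *
      ((-I * t) ^ p.2 / (p.2.factorial : ℂ) * sineMoment Q p.2 (n + 2 * p.1 + 1)) := by
  set r := (Real.sqrt Q)⁻¹ with hr
  have hr0 : 0 ≤ r := by positivity
  have hr1 : r < 1 := by
    refine inv_lt_one_of_one_lt₀ ?_
    rw [Real.lt_sqrt zero_le_one]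
    exact_mod_cast (by omega : 1 ^ 2 < Q)
  have hgeom : Summable fun k : ℕ => r ^ (n + 2 * k) * Real.pi := by
    simp_rw [pow_add, pow_mul]
    exact ((summable_geometric_of_lt_one (by positivity)
      (pow_lt_one₀ hr0 hr1 two_ne_zero)).mul_left _).mul_right _
  have hprod := hgeom.mul_of_nonneg (Real.summable_pow_div_factorial |t|)
    (fun k => by simp only [Pi.zero_apply]; positivity)
    (fun k => by simp only [Pi.zero_apply]; positivity)
  refine Summable.of_norm_bounded hprod fun p => ?_
  rw [norm_mul, norm_mul, norm_neg_I_mul_pow_div_factorial, Complex.norm_real, Complex.norm_real,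
    Real.norm_of_nonneg (by positivity), Real.norm_eq_abs, mul_assoc, mul_comm Real.pi]
  gcongr
  exact abs_sineMoment_le hQ _ _

/-- Power series expansion in time of the Schrödinger kernel. -/
theorem hasSum_schKernel {Q : ℕ} (hQ : 2 ≤ Q) (t : ℝ) (n : ℕ) :
    HasSum (fun j : ℕ => (-I * t) ^ j / (j.factorial : ℂ) * walkKernel Q j n)
      (Complex.exp (-(I * t)) * schKernel Q t n) := by
  have hsum := ((summable_geometric_mul_sineMoment hQ t n).mul_left (2 / Real.pi : ℂ)).hasSum
  have hk := hsum.prod_fiberwise fun k => ((hasSum_integral_schKernel hQ t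
    (n + 2 * k + 1)).mul_left (((Real.sqrt Q)⁻¹ ^ (n + 2 * k) : ℝ) : ℂ)).mul_left (2 / Real.pi : ℂ)
  have hj := ((Equiv.prodComm ℕ ℕ).hasSum_iff.2 hsum).prod_fiberwise fun j => by
    have h := (Complex.hasSum_ofReal.2 (hasSum_walkKernel hQ j n)).mul_left
      ((-I * t) ^ j / (j.factorial : ℂ))
    convert! h using 2 with k
    simp only [Function.comp_apply, Equiv.prodComm_apply, Prod.fst_swap, Prod.snd_swap]
    push_cast
    ring
  rw [schKernel, mul_assoc, ← mul_assoc, ← Complex.exp_add, neg_add_cancel, Complex.exp_zero,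
    one_mul, ← tsum_mul_left]
  simp_rw [rpow_neg_half_sub_eq hQ]
  rwa [hk.tsum_eq]

namespace HomTree

variable {Q : ℕ} (T : HomTree Q)

section Average

variable {E : Type*} [NormedAddCommGroup E] [NormedSpace ℝ E]

/-- The average of a function over the neighbours of a vertex. -/
def avg (g : T.V → E) (x : T.V) : E := (Q + 1 : ℝ)⁻¹ • ∑ y ∈ T.nbr x, g y

theorem avg_walkKernel (j : ℕ) (x z : T.V) :
    T.avg (fun y => walkKernel Q j (T.graph.dist y z)) x =
      walkKernel Q (j + 1) (T.graph.dist x z) := by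
  rw [avg, smul_eq_mul]
  rcases h : T.graph.dist x z with _ | m
  · obtain rfl := (T.isTree.connected.dist_eq_zero_iff).1 h
    rw [sum_nbr_self, walkKernel]
    field_simp
  · rw [T.sum_nbr_of_dist_eq_succ _ h, walkKernel]
    field_simp

theorem hasSum_walkKernel_smul (g : T.V → E) (j : ℕ) (x : T.V) :
    HasSum (fun z => walkKernel Q j (T.graph.dist x z) • g z) (T.avg^[j] g x) := by
  induction j generalizing x with
  | zero =>
    have h0 : ∀ z, z ≠ x → walkKernel Q 0 (T.graph.dist x z) • g z = 0 := fun z hz => by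
      have : T.graph.dist x z ≠ 0 := fun h =>
        hz ((T.isTree.connected.dist_eq_zero_iff).1 h).symm
      simp [walkKernel, this]
    simpa [walkKernel] using hasSum_single x h0
  | succ j ih =>
    rw [Function.iterate_succ_apply']
    convert! (hasSum_sum fun y (_ : y ∈ T.nbr x) => ih y).const_smul (Q + 1 : ℝ)⁻¹ using 2 with z
    rw [← avg_walkKernel, avg, smul_assoc, Finset.sum_smul]

theorem norm_avg_le (g : T.V → E) (x : T.V) : ‖T.avg g x‖ ≤ T.avg (fun y => ‖g y‖) x := by
  rw [avg, norm_smul, Real.norm_of_nonneg (by positivity)]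
  exact mul_le_mul_of_nonneg_left (norm_sum_le _ _) (by positivity)

theorem avg_le_of_le {g : T.V → ℝ} {c : ℝ} (hg : ∀ y, g y ≤ c) (x : T.V) : T.avg g x ≤ c := by
  have h := Finset.sum_le_card_nsmul (T.nbr x) g c fun y _ => hg y
  rw [card_nbr, nsmul_eq_mul] at h
  rw [avg, smul_eq_mul, inv_mul_le_iff₀ (by positivity)]
  exact_mod_cast h

theorem iterate_avg_le_of_le {g : T.V → ℝ} {c : ℝ} (hg : ∀ y, g y ≤ c) (j : ℕ) (x : T.V) :
    T.avg^[j] g x ≤ c := by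
  induction j generalizing x with
  | zero => exact hg x
  | succ j ih => rw [Function.iterate_succ_apply']; exact T.avg_le_of_le ih x

end Average

end HomTree

namespace HomTree

variable {Q : ℕ} (T : HomTree Q)

/-- The set of oriented edges of the tree. -/
def edges : Set (T.V × T.V) := {p | T.graph.Adj p.1 p.2}

theorem hasSum_indicator_edges {M : Type*} [AddCommMonoid M] [TopologicalSpace M]
    (c : T.V × T.V → M) (x : T.V) :
    HasSum (fun y => T.edges.indicator c (x, y)) (∑ y ∈ T.nbr x, c (x, y)) := by
  have h : ∀ y ∈ T.nbr x, T.edges.indicator c (x, y) = c (x, y) := fun y hy =>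
    Set.indicator_of_mem (s := T.edges) (T.mem_nbr.1 hy) c
  rw [← Finset.sum_congr rfl h]
  exact hasSum_sum_of_ne_finset_zero fun y hy =>
    Set.indicator_of_notMem (s := T.edges) (fun h' => hy (T.mem_nbr.2 h')) c

theorem indicator_edges_swap {M : Type*} [Zero M] (c : T.V × T.V → M) (p : T.V × T.V) :
    T.edges.indicator c p.swap = T.edges.indicator (fun p => c p.swap) p := by
  have : p.swap ∈ T.edges ↔ p ∈ T.edges := T.graph.adj_comm _ _
  by_cases h : p ∈ T.edges
  · rw [Set.indicator_of_mem h, Set.indicator_of_mem (this.2 h)]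
  · rw [Set.indicator_of_notMem h, Set.indicator_of_notMem (mt this.1 h)]

theorem hasSum_edges_fst {a : T.V → ℝ} (ha : ∀ x, 0 ≤ a x) {s : ℝ} (hs : HasSum a s) :
    HasSum (T.edges.indicator fun p => a p.1) ((Q + 1) * s) := by
  have hfib : ∀ x, HasSum (fun y => T.edges.indicator (fun p => a p.1) (x, y)) ((Q + 1) * a x) :=
    fun x => by
      convert! T.hasSum_indicator_edges (fun p => a p.1) x using 1
      simp [card_nbr]
  have hsum : Summable (T.edges.indicator fun p => a p.1) := by
    rw [summable_prod_of_nonneg (Set.indicator_nonneg fun p _ => ha p.1)]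
    refine ⟨fun x => (hfib x).summable, ?_⟩
    simp_rw [fun x => (hfib x).tsum_eq]
    exact hs.summable.mul_left _
  rw [← (hsum.hasSum.prod_fiberwise hfib).unique (hs.mul_left _)]
  exact hsum.hasSum

theorem hasSum_edges_snd {a : T.V → ℝ} (ha : ∀ x, 0 ≤ a x) {s : ℝ} (hs : HasSum a s) :
    HasSum (T.edges.indicator fun p => a p.2) ((Q + 1) * s) := by
  rw [← (Equiv.prodComm T.V T.V).hasSum_iff]
  convert! T.hasSum_edges_fst ha hs using 1
  exact funext fun p => T.indicator_edges_swap (fun p => a p.2) p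

theorem hasSum_avg {a : T.V → ℝ} (ha : ∀ x, 0 ≤ a x) {s : ℝ} (hs : HasSum a s) :
    HasSum (T.avg a) s := by
  have h := ((T.hasSum_edges_snd ha hs).prod_fiberwise fun x =>
    T.hasSum_indicator_edges (fun p => a p.2) x).mul_left (Q + 1 : ℝ)⁻¹
  rwa [inv_mul_cancel_left₀ (by positivity)] at h

theorem norm_avg_sq_le {E : Type*} [NormedAddCommGroup E] [NormedSpace ℝ E] (g : T.V → E)
    (x : T.V) : ‖T.avg g x‖ ^ 2 ≤ T.avg (fun y => ‖g y‖ ^ 2) x := by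
  refine (pow_le_pow_left₀ (norm_nonneg _) (T.norm_avg_le g x) 2).trans ?_
  have h := sq_sum_le_card_mul_sum_sq (s := T.nbr x) (f := fun y => ‖g y‖)
  rw [card_nbr] at h
  push_cast at h
  simp only [avg, smul_eq_mul, mul_pow]
  rw [inv_pow, sq (Q + 1 : ℝ), mul_inv, mul_assoc]
  gcongr
  rwa [inv_mul_le_iff₀ (by positivity)]

/-- The Hilbert space `ℓ²` of the vertex set. -/
abbrev L2 : Type := lp (fun _ : T.V => ℂ) 2

variable {T} in
theorem L2.hasSum_norm_sq (g : T.L2) : HasSum (fun x => ‖g x‖ ^ 2) (‖g‖ ^ 2) := by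
  have := lp.hasSum_norm (p := 2) (by norm_num) g
  simpa using this

theorem memℓp_two_iff {g : T.V → ℂ} : Memℓp g 2 ↔ Summable fun x => ‖g x‖ ^ 2 := by
  rw [memℓp_gen_iff (by norm_num)]
  simp

theorem memℓp_avg (g : T.L2) : Memℓp (T.avg g) 2 := by
  rw [memℓp_two_iff]
  exact (T.hasSum_avg (fun x => sq_nonneg _) g.hasSum_norm_sq).summable.of_nonneg_of_le
    (fun x => sq_nonneg _) (T.norm_avg_sq_le g)

/-- The averaging operator on `ℓ²`. -/
def avgCLM : T.L2 →L[ℂ] T.L2 :=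
  LinearMap.mkContinuous
    { toFun := fun g => ⟨T.avg g, T.memℓp_avg g⟩
      map_add' := fun g h => by
        ext x
        change T.avg (fun y => g y + h y) x = T.avg g x + T.avg h x
        simp only [avg, Finset.sum_add_distrib, smul_add]
      map_smul' := fun c g => by
        ext x
        simp [avg, ← Finset.mul_sum, mul_left_comm] }
    1 fun g => by
      rw [one_mul, ← sq_le_sq₀ (norm_nonneg _) (norm_nonneg _)]
      exact hasSum_le (T.norm_avg_sq_le g)
        (L2.hasSum_norm_sq (⟨T.avg g, T.memℓp_avg g⟩ : T.L2))
        (T.hasSum_avg (fun x => sq_nonneg _) g.hasSum_norm_sq)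

@[simp]
theorem coe_avgCLM (g : T.L2) : ⇑(T.avgCLM g) = T.avg g := rfl

theorem coe_avgCLM_pow (g : T.L2) (j : ℕ) : ⇑((T.avgCLM ^ j) g) = T.avg^[j] g := by
  induction j with
  | zero => simp
  | succ j ih => rw [pow_succ', mul_apply_eq_comp, coe_avgCLM, ih, Function.iterate_succ_apply']

theorem im_inner_avgCLM (u : T.L2) : (inner ℂ u (T.avgCLM u)).im = 0 := by
  set c : T.V × T.V → ℂ := fun p => u p.2 * (starRingEnd ℂ) (u p.1) with hc
  have hsum : Summable (T.edges.indicator c) := by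
    have hu := u.hasSum_norm_sq
    refine Summable.of_norm_bounded ((T.hasSum_edges_fst (fun x => sq_nonneg _) hu).add
      (T.hasSum_edges_snd (fun x => sq_nonneg _) hu)).summable fun p => ?_
    by_cases h : p ∈ T.edges
    · simp only [Set.indicator_of_mem h, hc, norm_mul, RCLike.norm_conj]
      nlinarith [sq_nonneg (‖u p.1‖ - ‖u p.2‖), sq_nonneg (‖u p.1‖), sq_nonneg ‖u p.2‖]
    · simp [Set.indicator_of_notMem h]
  have hconj : (starRingEnd ℂ) (∑' p, T.edges.indicator c p) = ∑' p, T.edges.indicator c p := by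
    rw [Complex.conj_tsum, ← (Equiv.prodComm T.V T.V).tsum_eq]
    refine tsum_congr fun p => ?_
    rw [Equiv.prodComm_apply, indicator_edges_swap]
    by_cases h : p ∈ T.edges
    · simp [Set.indicator_of_mem h, hc, mul_comm]
    · simp [Set.indicator_of_notMem h]
  have h1 : HasSum (fun x => inner ℂ (u x) (T.avgCLM u x))
      ((Q + 1 : ℂ)⁻¹ * ∑' p, T.edges.indicator c p) := by
    convert! (hsum.hasSum.prod_fiberwise (T.hasSum_indicator_edges c)).mul_left
      (Q + 1 : ℂ)⁻¹ using 2 with x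
    simp [avg, hc, Finset.sum_mul, mul_assoc]
  rw [(lp.hasSum_inner u (T.avgCLM u)).unique h1, ← Complex.conj_eq_iff_im, map_mul, hconj]
  simp

theorem im_inner_one_sub_avgCLM (u : T.L2) :
    (inner ℂ u ((1 - T.avgCLM : T.L2 →L[ℂ] T.L2) u)).im = 0 := by
  have h := inner_self_im (𝕜 := ℂ) u
  simp only [RCLike.im_to_complex] at h
  rw [sub_apply, one_apply_eq_self, inner_sub_right, Complex.sub_im,
    im_inner_avgCLM, h, sub_zero]

end HomTree

namespace HomTree

variable {Q : ℕ} (T : HomTree Q)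

theorem hasSum_expGroup_apply (t : ℝ) (g : T.L2) (x : T.V) :
    HasSum (fun j : ℕ => (-I * t) ^ j / (j.factorial : ℂ) * T.avg^[j] g x)
      (Complex.exp (-(I * t)) * expGroup (1 - T.avgCLM) t g x) := by
  have h := NormedSpace.exp_series_hasSum_exp' (𝕂 := ℂ) ((-I * t : ℂ) • T.avgCLM)
  have h' := h.mapL ((ContinuousLinearMap.apply ℂ T.L2 g : (T.L2 →L[ℂ] T.L2) →L[ℂ] T.L2))
  rw [exp_smul_eq_smul_expGroup_one_sub] at h'
  convert! h'.mapL (lp.evalCLM ℂ (fun _ : T.V => ℂ) 2 x) using 2 with j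
  change _ = (((j.factorial : ℂ)⁻¹ • ((-I * t : ℂ) • T.avgCLM) ^ j) g) x
  rw [smul_pow, smul_smul, smul_apply, lp.coeFn_smul, Pi.smul_apply, coe_avgCLM_pow, smul_eq_mul,
    div_eq_inv_mul]

theorem summable_walkKernel_mul (t : ℝ) (g : T.L2) (x : T.V) :
    Summable fun p : ℕ × T.V => (-I * t) ^ p.1 / (p.1.factorial : ℂ) *
      (walkKernel Q p.1 (T.graph.dist x p.2) * g p.2) := by
  set G : T.V → ℝ := fun y => ‖g y‖
  have hG : ∀ y, G y ≤ ‖g‖ := fun y => lp.norm_apply_le_norm two_ne_zero g y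
  refine Summable.of_norm ?_
  have hn : ∀ j z, ‖(-I * t) ^ j / (j.factorial : ℂ) *
      (walkKernel Q j (T.graph.dist x z) * g z)‖ =
      |t| ^ j / j.factorial * (walkKernel Q j (T.graph.dist x z) • G z) := fun j z => by
    rw [norm_mul, norm_neg_I_mul_pow_div_factorial, norm_mul, Complex.norm_real,
      Real.norm_of_nonneg (walkKernel_nonneg _ _ _), smul_eq_mul]
  have hs : ∀ j, HasSum (fun z => ‖(-I * t) ^ j / (j.factorial : ℂ) *
      (walkKernel Q j (T.graph.dist x z) * g z)‖) (|t| ^ j / j.factorial * T.avg^[j] G x) :=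
    fun j => by
      simp_rw [hn]
      exact (T.hasSum_walkKernel_smul G j x).mul_left _
  rw [summable_prod_of_nonneg fun _ => norm_nonneg _]
  refine ⟨fun j => (hs j).summable, ?_⟩
  simp_rw [fun j => (hs j).tsum_eq]
  refine ((Real.summable_pow_div_factorial |t|).mul_right ‖g‖).of_nonneg_of_le (fun j => ?_)
    fun j => ?_
  · rw [← (hs j).tsum_eq]
    exact tsum_nonneg fun _ => norm_nonneg _
  · gcongr
    exact T.iterate_avg_le_of_le hG j x

/-- The convolution with the radial Schrödinger kernel is the unitary group generated by the
combinatorial Laplacian. -/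
theorem propagate_eq_expGroup (hQ : 2 ≤ Q) (t : ℝ) (g : T.L2) (x : T.V) :
    propagate T t g x = expGroup (1 - T.avgCLM) t g x := by
  have hsum := T.summable_walkKernel_mul t g x
  have hfib : ∀ y, HasSum (fun j : ℕ => (-I * t) ^ j / (j.factorial : ℂ) *
      (walkKernel Q j (T.graph.dist x y) * g y))
      (Complex.exp (-(I * t)) * (schKernel Q t (T.graph.dist x y) * g y)) := fun y => by
    simpa only [mul_assoc] using (hasSum_schKernel hQ t (T.graph.dist x y)).mul_right (g y)
  have htot : HasSum (fun y => Complex.exp (-(I * t)) * (schKernel Q t (T.graph.dist x y) * g y))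
      (Complex.exp (-(I * t)) * expGroup (1 - T.avgCLM) t g x) := by
    have h1 := hsum.hasSum.prod_fiberwise fun j =>
      (T.hasSum_walkKernel_smul g j x).mul_left ((-I * t) ^ j / (j.factorial : ℂ))
    rw [(T.hasSum_expGroup_apply t g x).unique h1]
    exact ((Equiv.prodComm _ _).hasSum_iff.2 hsum.hasSum).prod_fiberwise hfib
  have hne := Complex.exp_ne_zero (-(I * t))
  have htot' : HasSum (fun y => schKernel Q t (T.graph.dist x y) * g y)
      (expGroup (1 - T.avgCLM) t g x) := by
    convert! htot.mul_left (Complex.exp (-(I * t)))⁻¹ using 2 <;>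
    rw [inv_mul_cancel_left₀ hne]
  have hσ := (Equiv.sigmaFiberEquiv fun y => T.graph.dist x y).hasSum_iff.2 htot'
  rw [propagate, ← hσ.tsum_eq, hσ.summable.tsum_sigma]
  refine tsum_congr fun n => ?_
  rw [sphereSum, ← tsum_mul_left]
  refine tsum_congr fun y => ?_
  simp [Equiv.sigmaFiberEquiv, y.2]

end HomTree

namespace HomTree

variable {Q : ℕ} (T : HomTree Q)

theorem L2.norm_le_of_forall_norm_le {T : HomTree Q} {g h : T.L2} {c : ℝ} (hc : 0 ≤ c)
    (hgh : ∀ x, ‖h x‖ ≤ c * ‖g x‖) : ‖h‖ ≤ c * ‖g‖ := by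
  rw [← sq_le_sq₀ (norm_nonneg _) (by positivity), mul_pow]
  refine hasSum_le (fun x => ?_) h.hasSum_norm_sq (g.hasSum_norm_sq.mul_left _)
  rw [← mul_pow]
  exact pow_le_pow_left₀ (norm_nonneg _) (hgh x) 2

theorem memℓp_of_forall_norm_le (g : T.L2) {h : T.V → ℂ} {c : ℝ}
    (hgh : ∀ x, ‖h x‖ ≤ c * ‖g x‖) : Memℓp h 2 := by
  rw [memℓp_two_iff]
  refine (g.hasSum_norm_sq.summable.mul_left (c ^ 2)).of_nonneg_of_le (fun _ => sq_nonneg _)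
    fun x => ?_
  rw [← mul_pow]
  exact pow_le_pow_left₀ (norm_nonneg _) (hgh x) 2

theorem memℓp_comp_powerLike {F : ℂ → ℂ} {γ : ℝ} (hγ : 1 < γ) (hF : PowerLike F γ) (g : T.L2) :
    Memℓp (fun x => F (g x)) 2 := by
  obtain ⟨C, hC, hF, -⟩ := hF
  refine T.memℓp_of_forall_norm_le g (c := C * ‖g‖ ^ (γ - 1)) fun x => (hF _).trans ?_
  have h1 : ‖g x‖ ^ γ = ‖g x‖ ^ (γ - 1) * ‖g x‖ := by
    rw [← Real.rpow_add_one' (norm_nonneg _) (by linarith), sub_add_cancel]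
  rw [h1, ← mul_assoc]
  gcongr
  exact lp.norm_apply_le_norm two_ne_zero g x

/-- The superposition operator of a power-like nonlinearity on `ℓ²`. -/
def superposition {F : ℂ → ℂ} {γ : ℝ} (hγ : 1 < γ) (hF : PowerLike F γ) (g : T.L2) : T.L2 :=
  ⟨fun x => F (g x), T.memℓp_comp_powerLike hγ hF g⟩

theorem exists_lipschitzOnWith_superposition {F : ℂ → ℂ} {γ : ℝ} (hγ : 1 < γ)
    (hF : PowerLike F γ) (R : ℝ) :
    ∃ K, LipschitzOnWith K (T.superposition hγ hF) (Metric.closedBall 0 R) := by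
  obtain ⟨C, hC, -, hlip⟩ := id hF
  refine ⟨Real.toNNReal (C * (|R| ^ (γ - 1) + |R| ^ (γ - 1))),
    LipschitzOnWith.of_dist_le_mul fun u hu v hv => ?_⟩
  rw [mem_closedBall_zero_iff] at hu hv
  rw [Real.coe_toNNReal _ (by positivity), dist_eq_norm, dist_eq_norm]
  refine L2.norm_le_of_forall_norm_le (by positivity) fun x => (hlip (u x) (v x)).trans ?_
  have hγ' : 0 ≤ γ - 1 := by linarith
  have hux := (lp.norm_apply_le_norm two_ne_zero u x).trans (hu.trans (le_abs_self R))
  have hvx := (lp.norm_apply_le_norm two_ne_zero v x).trans (hv.trans (le_abs_self R))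
  rw [lp.coeFn_sub, Pi.sub_apply]
  gcongr

theorem im_inner_superposition {F : ℂ → ℂ} {γ : ℝ} (hγ : 1 < γ) (hF : PowerLike F γ)
    (hgauge : GaugeInvariant F) (u : T.L2) : (inner ℂ u (T.superposition hγ hF u)).im = 0 := by
  refine (Complex.hasSum_im (lp.hasSum_inner u (T.superposition hγ hF u))).unique ?_
  convert! (hasSum_zero : HasSum (fun _ : T.V => (0 : ℝ)) 0) using 2 with x
  exact hgauge (u x)

theorem spaceNorm_two_eq_enorm (g : T.L2) : spaceNorm T 2 g = ‖g‖ₑ := by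
  have h : ∀ x, ((‖g x‖₊ : ℝ≥0∞)) ^ (2 : ℝ≥0∞).toReal = ENNReal.ofReal (‖g x‖ ^ 2) := fun x => by
    rw [ENNReal.ofReal_pow (norm_nonneg _), ofReal_norm, ← enorm_eq_nnnorm]
    simp
  rw [spaceNorm, if_neg (by simp), tsum_congr h, ← ENNReal.ofReal_tsum_of_nonneg
    (fun x => sq_nonneg _) g.hasSum_norm_sq.summable, g.hasSum_norm_sq.tsum_eq,
    ENNReal.ofReal_pow (norm_nonneg _), ofReal_norm, ← ENNReal.rpow_natCast, ← ENNReal.rpow_mul]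
  simp

theorem memℓp_of_spaceNorm_lt_top {g : T.V → ℂ} (hg : spaceNorm T 2 g < ∞) : Memℓp g 2 := by
  rw [memℓp_two_iff]
  rw [spaceNorm, if_neg (by simp), ENNReal.rpow_lt_top_iff_of_pos (by simp)] at hg
  convert! ENNReal.summable_toReal hg.ne using 2 with x
  simp

theorem spaceNorm_ofReal_le_enorm {q : ℝ} (hq : 2 ≤ q) (g : T.L2) :
    spaceNorm T (ENNReal.ofReal q) g ≤ ‖g‖ₑ := by
  have hq0 : 0 < q := by linarith
  rw [spaceNorm, if_neg ENNReal.ofReal_ne_top, ENNReal.toReal_ofReal hq0.le, one_div,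
    ENNReal.rpow_inv_le_iff hq0]
  have hsum := g.hasSum_norm_sq.mul_left (‖g‖ ^ (q - 2))
  have hpow : ∀ a : ℝ, 0 ≤ a → a ^ (q - 2) * a ^ 2 = a ^ q := fun a ha => by
    rw [← Real.rpow_natCast, ← Real.rpow_add_of_nonneg ha (by linarith) (by norm_num)]
    norm_num
  calc ∑' x, (‖g x‖₊ : ℝ≥0∞) ^ q ≤ ∑' x, ENNReal.ofReal (‖g‖ ^ (q - 2) * ‖g x‖ ^ 2) := by
        refine ENNReal.tsum_le_tsum fun x => ?_
        rw [← enorm_eq_nnnorm, ← ofReal_norm, ENNReal.ofReal_rpow_of_nonneg (norm_nonneg _) hq0.le,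
          ← hpow _ (norm_nonneg _)]
        refine ENNReal.ofReal_le_ofReal ?_
        gcongr
        exact lp.norm_apply_le_norm two_ne_zero g x
    _ = ‖g‖ₑ ^ q := by
        rw [← ENNReal.ofReal_tsum_of_nonneg (fun x => by positivity) hsum.summable, hsum.tsum_eq,
          hpow _ (norm_nonneg _), ← ofReal_norm,
          ENNReal.ofReal_rpow_of_nonneg (norm_nonneg _) hq0.le]

theorem mixedNorm_lt_top {p q : ℝ} (hp : 0 < p) (hq : 2 ≤ q) {U : ℝ → T.L2} (hU : Continuous U)
    (R : ℝ) : mixedNorm T (ENNReal.ofReal p) (ENNReal.ofReal q) (Set.Icc (-R) R)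
      (fun t => U t) < ∞ := by
  obtain ⟨M, hM⟩ := (isCompact_Icc.image_of_continuousOn (s := Set.Icc (-R) R)
    hU.continuousOn).isBounded.exists_norm_le
  rw [mixedNorm, if_neg ENNReal.ofReal_ne_top, ENNReal.toReal_ofReal hp.le]
  refine ENNReal.rpow_lt_top_of_nonneg (by positivity) (ne_of_lt ?_)
  calc ∫⁻ t in Set.Icc (-R) R, spaceNorm T (ENNReal.ofReal q) (U t) ^ p
      ≤ ∫⁻ _ in Set.Icc (-R) R, ENNReal.ofReal M ^ p := by
        refine setLIntegral_mono measurable_const fun t ht => ?_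
        refine ENNReal.rpow_le_rpow ((T.spaceNorm_ofReal_le_enorm hq _).trans ?_) hp.le
        rw [← ofReal_norm]
        exact ENNReal.ofReal_le_ofReal (hM _ ⟨t, ht, rfl⟩)
    _ < ∞ := by
        rw [setLIntegral_const]
        exact ENNReal.mul_lt_top (ENNReal.rpow_lt_top_of_nonneg hp.le ENNReal.ofReal_ne_top)
          measure_Icc_lt_top

theorem contL2On_univ_iff {U : ℝ → T.L2} : ContL2On T (fun t => U t) Set.univ ↔ Continuous U := by
  simp only [ContL2On, Set.mem_univ, forall_const, nhdsWithin_univ, continuous_iff_continuousAt,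
    ContinuousAt]
  refine forall_congr' fun t₀ => ?_
  rw [tendsto_iff_edist_tendsto_0]
  simp_rw [edist_eq_enorm_sub, ← spaceNorm_two_eq_enorm]
  rfl

theorem solvesNLS_univ_iff (hQ : 2 ≤ Q) {F : ℂ → ℂ} {γ : ℝ} (hγ : 1 < γ) (hF : PowerLike F γ)
    (f : T.L2) {U : ℝ → T.L2} (hU : Continuous U) :
    SolvesNLS T F f (fun t => U t) Set.univ ↔
      IsDuhamelSolution (1 - T.avgCLM) (T.superposition hγ hF) f U := by
  set N := T.superposition hγ hF with hN
  have hNc : Continuous N :=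
    continuous_of_lipschitzOnWith_closedBall (T.exists_lipschitzOnWith_superposition hγ hF)
  have hcont : ∀ t, Continuous fun s => expGroup (1 - T.avgCLM) (t - s) (N (U s)) := fun t =>
    ((continuous_expGroup _).comp (continuous_const.sub continuous_id)).clm_apply (hNc.comp hU)
  simp only [SolvesNLS, Set.mem_univ, forall_const, IsDuhamelSolution]
  refine forall_congr' fun t => ?_
  have hint : ∀ x, (∫ s in (0 : ℝ)..t, propagate T (t - s) (fun y => F (U s y)) x) =
      (∫ s in (0 : ℝ)..t, expGroup (1 - T.avgCLM) (t - s) (N (U s)) : T.L2) x := fun x => by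
    refine Eq.trans ?_ ((lp.evalCLM ℂ (fun _ : T.V => ℂ) 2 x).intervalIntegral_comp_comm
      ((hcont t).intervalIntegrable 0 t))
    refine intervalIntegral.integral_congr fun s _ => ?_
    exact T.propagate_eq_expGroup hQ (t - s) (N (U s)) x
  simp_rw [T.propagate_eq_expGroup hQ, hint]
  rw [lp.ext_iff, funext_iff]
  rfl

end HomTree

/-- Global well-posedness for arbitrary `L²` data under gauge invariance: for
every `1 < γ < ∞`, every gauge-invariant power-like nonlinearity `F` of degree
`γ`, suitable exponents `p ∈ [2,∞)`, `q ∈ (2,∞)` with `p > γ`, `q < 2γ`, and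
every `f ∈ L²(𝕋)`, the NLS (in Duhamel form) has a unique global solution
`u ∈ C(ℝ; L²(𝕋)) ∩ L^p_loc(ℝ; L^q(𝕋))`. -/
theorem global_wellposedness_gauge_invariant (Q : ℕ) (hQ : 2 ≤ Q)
    (T : HomTree Q) (γ : ℝ) (hγ : 1 < γ) (F : ℂ → ℂ) (hF : PowerLike F γ)
    (hgauge : GaugeInvariant F)
    (p q : ℝ) (hp : 2 ≤ p) (hq : 2 < q) (hpγ : γ < p) (hqγ : q < 2 * γ)
    (f : T.V → ℂ) (hf : spaceNorm T 2 f < ∞) :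
    ∃! u : ℝ → T.V → ℂ,
      SolvesNLS T F f u Set.univ ∧ ContL2On T u Set.univ ∧
      (∀ t : ℝ, spaceNorm T 2 (u t) < ∞) ∧
      ∀ R : ℝ, 0 < R →
        mixedNorm T (ENNReal.ofReal p) (ENNReal.ofReal q) (Set.Icc (-R) R) u < ∞ := by
  set f' : T.L2 := ⟨f, T.memℓp_of_spaceNorm_lt_top hf⟩ with hf'
  obtain ⟨U, ⟨hUc, hUD⟩, huniq⟩ := existsUnique_duhamelSolution
    T.im_inner_one_sub_avgCLM (T.exists_lipschitzOnWith_superposition (γ := γ) hγ hF)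
    (T.im_inner_superposition hγ hF hgauge) f'
  refine ⟨fun t => U t, ⟨(T.solvesNLS_univ_iff hQ hγ hF f' hUc).2 hUD,
    T.contL2On_univ_iff.2 hUc, fun t => ?_, fun R _ => T.mixedNorm_lt_top (by linarith) hq.le hUc R⟩,
    ?_⟩
  · rw [T.spaceNorm_two_eq_enorm]
    exact enorm_lt_top
  · rintro v ⟨hv, hvc, hvfin, -⟩
    set W : ℝ → T.L2 := fun t => ⟨v t, T.memℓp_of_spaceNorm_lt_top (hvfin t)⟩ with hW
    have hWc : Continuous W := T.contL2On_univ_iff.1 hvc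
    have := huniq W ⟨hWc, (T.solvesNLS_univ_iff hQ hγ hF f' hWc).1 hv⟩
    rw [← this]
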